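/- Let F₁ and F₂ be two coprime polynomials in ℝ[u,v] (in particular F₁² + F₂² ≠ 0). Suppose that a real polynomial I ∈ ℝ[u,v] divides F₁² + F₂² and I is not constant; then deg_u I ≥ 2 or deg_v I ≥ 2. -/

import Mathlib

open MvPolynomial

noncomputable section

/-- The ring `ℝ[u,v]`, where `u` is the variable `X 0` and `v` is the variable `X 1`. -/
abbrev RP2 : Type := MvPolynomial (Fin 2) ℝ

/-- Pseudo-division by the linear polynomial `a X + b`. -/
lemma exists_dvd_C_pow_mul_sub_C {R : Type*} [CommRing R] (a b : R) (F : Polynomial R) :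
    ∃ (n : ℕ) (r : R), Polynomial.C a * Polynomial.X + Polynomial.C b ∣
      Polynomial.C a ^ n * F - Polynomial.C r := by
  induction F using Polynomial.induction_on with
  | C c => exact ⟨0, c, by simp⟩
  | add p q hp hq =>
    obtain ⟨n, r, A, hA⟩ := hp
    obtain ⟨m, s, B, hB⟩ := hq
    refine ⟨n + m, a ^ m * r + a ^ n * s,
      Polynomial.C a ^ m * A + Polynomial.C a ^ n * B, ?_⟩
    simp only [map_add, map_mul, map_pow]
    linear_combination Polynomial.C a ^ m * hA + Polynomial.C a ^ n * hB
  | monomial k c h =>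
    obtain ⟨n, r, A, hA⟩ := h
    refine ⟨n + 1, -(b * r), Polynomial.C a * Polynomial.X * A + Polynomial.C r, ?_⟩
    simp only [map_neg, map_mul]
    linear_combination Polynomial.C a * Polynomial.X * hA

/-- Over a domain in which a sum of two squares vanishes only trivially, a prime polynomial of
degree one dividing `F² + G²` divides both `F` and `G`. -/
lemma Prime.dvd_and_dvd_of_dvd_sq_add_sq {R : Type*} [CommRing R] [IsDomain R]
    (hR : ∀ r s : R, r ^ 2 + s ^ 2 = 0 → r = 0 ∧ s = 0)
    {P F G : Polynomial R} (hP : Prime P) (hdeg : P.natDegree = 1)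
    (h : P ∣ F ^ 2 + G ^ 2) : P ∣ F ∧ P ∣ G := by
  obtain ⟨a, ha, b, rfl⟩ := Polynomial.natDegree_eq_one.mp hdeg
  have hC : ∀ c : R, Polynomial.C a * Polynomial.X + Polynomial.C b ∣ Polynomial.C c → c = 0 := by
    intro c hc
    by_contra hc0
    have := Polynomial.natDegree_le_of_dvd hc (by simpa using hc0)
    rw [hdeg, Polynomial.natDegree_C] at this
    omega
  have key : ∀ (H : Polynomial R) (n : ℕ),
      Polynomial.C a * Polynomial.X + Polynomial.C b ∣ Polynomial.C a ^ n * H →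
      Polynomial.C a * Polynomial.X + Polynomial.C b ∣ H := fun H n hd ↦
    (hP.dvd_or_dvd hd).resolve_left fun h' ↦ ha (hC a (hP.dvd_of_dvd_pow h'))
  obtain ⟨n, r, A, hA⟩ := exists_dvd_C_pow_mul_sub_C a b F
  obtain ⟨m, s, B, hB⟩ := exists_dvd_C_pow_mul_sub_C a b G
  obtain ⟨Q, hQ⟩ := h
  obtain ⟨h1, h2⟩ := hR (a ^ m * r) (a ^ n * s) <| hC _ <| by
    rw [map_add, map_pow, map_pow, map_mul, map_mul, map_pow, map_pow]
    refine ⟨Polynomial.C a ^ (2 * n + 2 * m) * Q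
      - Polynomial.C a ^ (2 * m) * A * (Polynomial.C a ^ n * F + Polynomial.C r)
      - Polynomial.C a ^ (2 * n) * B * (Polynomial.C a ^ m * G + Polynomial.C s), ?_⟩
    linear_combination Polynomial.C a ^ (2 * n + 2 * m) * hQ
      - Polynomial.C a ^ (2 * m) * (Polynomial.C a ^ n * F + Polynomial.C r) * hA
      - Polynomial.C a ^ (2 * n) * (Polynomial.C a ^ m * G + Polynomial.C s) * hB
  have hr : r = 0 := (mul_eq_zero.mp h1).resolve_left (pow_ne_zero _ ha)
  have hs : s = 0 := (mul_eq_zero.mp h2).resolve_left (pow_ne_zero _ ha)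
  subst hr hs
  exact ⟨key F n ⟨A, by simpa using hA⟩, key G m ⟨B, by simpa using hB⟩⟩

lemma MvPolynomial.eq_zero_of_sq_add_sq_eq_zero {σ : Type*} (r s : MvPolynomial σ ℝ)
    (h : r ^ 2 + s ^ 2 = 0) : r = 0 ∧ s = 0 := by
  have hx (x : σ → ℝ) : eval x r ^ 2 + eval x s ^ 2 = 0 := by
    simpa using congrArg (eval x) h
  constructor <;> refine MvPolynomial.funext fun x ↦ ?_ <;> rw [map_zero] <;>
    nlinarith [hx x, sq_nonneg (eval x r), sq_nonneg (eval x s)]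

lemma MvPolynomial.dvd_and_dvd_of_degreeOf_zero_eq_one {n : ℕ}
    {P F G : MvPolynomial (Fin (n + 1)) ℝ} (hP : Prime P) (hdeg : P.degreeOf 0 = 1)
    (h : P ∣ F ^ 2 + G ^ 2) : P ∣ F ∧ P ∣ G := by
  have := Prime.dvd_and_dvd_of_dvd_sq_add_sq eq_zero_of_sq_add_sq_eq_zero
    (P := finSuccEquiv ℝ n P) (F := finSuccEquiv ℝ n F) (G := finSuccEquiv ℝ n G)
    ((MulEquiv.prime_iff (finSuccEquiv ℝ n)).mpr hP)
    (by rw [natDegree_finSuccEquiv, hdeg])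
    (by simpa using map_dvd (finSuccEquiv ℝ n) h)
  simpa only [map_dvd_iff] using this

lemma MvPolynomial.dvd_and_dvd_of_degreeOf_eq_one {n : ℕ} (i : Fin (n + 1))
    {P F G : MvPolynomial (Fin (n + 1)) ℝ} (hP : Prime P) (hdeg : P.degreeOf i = 1)
    (h : P ∣ F ^ 2 + G ^ 2) : P ∣ F ∧ P ∣ G := by
  let e := renameEquiv ℝ (Equiv.swap i 0)
  have := dvd_and_dvd_of_degreeOf_zero_eq_one
    (P := e P) (F := e F) (G := e G) ((MulEquiv.prime_iff e).mpr hP)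
    (by
      have := degreeOf_rename_of_injective (p := P) (Equiv.swap i 0).injective i
      rw [Equiv.swap_apply_left] at this
      exact this.trans hdeg)
    (by simpa using map_dvd e h)
  simpa only [map_dvd_iff] using this

/-- Let `F₁, F₂ ∈ ℝ[u,v]` be coprime (their only common divisors are
constants; in particular `F₁² + F₂² ≠ 0`).  If a real polynomial `I` divides `F₁² + F₂²`
and `I` is not constant, then `deg_u I ≥ 2` or `deg_v I ≥ 2`. -/
theorem stmt_10
    (F1 F2 I : RP2)
    (hcop : ∀ D : RP2, D ∣ F1 → D ∣ F2 → IsUnit D)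
    (hne : F1 ^ 2 + F2 ^ 2 ≠ 0)
    (hdvd : I ∣ F1 ^ 2 + F2 ^ 2)
    (hnc : ¬∃ c : ℝ, I = MvPolynomial.C c) :
    2 ≤ I.degreeOf 0 ∨ 2 ≤ I.degreeOf 1 := by
  have hI : I ≠ 0 := ne_zero_of_dvd_ne_zero hne hdvd
  have hu : ¬IsUnit I := fun h ↦ by
    obtain ⟨c, -, hc⟩ := MvPolynomial.isUnit_iff_eq_C_of_isReduced.mp h
    exact hnc ⟨c, hc⟩
  obtain ⟨P, hPirr, hPI⟩ := WfDvdMonoid.exists_irreducible_factor hu hI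
  have hP : Prime P := hPirr.prime
  have hne1 (i : Fin 2) : P.degreeOf i ≠ 1 := fun hi ↦
    have h := dvd_and_dvd_of_degreeOf_eq_one i hP hi (hPI.trans hdvd)
    hP.not_isUnit (hcop P h.1 h.2)
  have hle (i : Fin 2) : P.degreeOf i ≤ I.degreeOf i := by
    obtain ⟨Q, rfl⟩ := hPI
    rw [degreeOf_mul_eq (left_ne_zero_of_mul hI) (right_ne_zero_of_mul hI)]
    exact Nat.le_add_right _ _
  by_contra! hlt
  have h0 (i : Fin 2) : P.degreeOf i = 0 := by
    have := hne1 i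
    have := hle i
    fin_cases i <;> simp at * <;> omega
  have hC : P = C (P.coeff 0) := by
    rw [← totalDegree_eq_zero_iff_eq_C, totalDegree_eq_zero_iff]
    intro m hm i
    exact Nat.le_zero.mp (h0 i ▸ monomial_le_degreeOf i hm)
  have hc : P.coeff 0 ≠ 0 := fun h ↦ hP.ne_zero (by rw [hC, h, C_0])
  exact hP.not_isUnit (hC ▸ (isUnit_iff_ne_zero.mpr hc).map C)

end
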